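/- arXiv:2110.00752 — 3 statements merged into one kernel-verified Lean document; each statement's English description precedes it below -/
import Mathlib

section
/- Let $T>0$ and let $\alpha\in C^1[0,T]$ satisfy $0<\alpha_*\le\alpha(t)\le\alpha^*<1$ on $[0,T]$. Let $g:[0,T]\to\mathbb{R}$ be continuous. Then for every $t\in(0,T)$ the function $\tau\mapsto \hat{\mathcal I}^{1-\alpha(\tau)}\big(\mathcal I^{\alpha(\cdot)}g\big)(\tau) = \int_0^\tau (\tau-s)^{\alpha(\tau)-1}\int_0^s (s-y)^{-\alpha(y)}g(y)\,dy\,ds$ is differentiable at $t$ with derivative $\gamma(t)\,g(t)+\int_0^t \mathcal K(s,t)\,g(s)\,ds$, where $\gamma(t)=\Gamma(\alpha(t))\Gamma(1-\alpha(t))$ and $\mathcal K(s,t)=\partial_t\big(B(\alpha(t),1-\alpha(s))\,(t-s)^{\alpha(t)-\alpha(s)}\big)$. -/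
open Set MeasureTheory Filter
open scoped Topology

/-- The Beta function `B(a,b) = Γ(a)Γ(b)/Γ(a+b)`. -/
noncomputable def betaFn (a b : ℝ) : ℝ := Real.Gamma a * Real.Gamma b / Real.Gamma (a + b)

theorem betaFn_pos {a b : ℝ} (ha : 0 < a) (hb : 0 < b) : 0 < betaFn a b :=
  ProbabilityTheory.beta_pos ha hb

theorem contDiffAt_realGamma {x : ℝ} (hx : 0 < x) : ContDiffAt ℝ 1 Real.Gamma x := by
  have h : ContDiffAt ℂ 1 Complex.Gamma x := by
    have hd : DifferentiableOn ℂ Complex.Gamma {z | 0 < z.re} := fun z hz =>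
      (Complex.differentiableAt_Gamma z fun m h => by
        have h' : z.re = -m := by simp [h]
        have : 0 < z.re := hz
        linarith [(Nat.cast_nonneg m : (0 : ℝ) ≤ m)]).differentiableWithinAt
    have ho : IsOpen {z : ℂ | 0 < z.re} := isOpen_lt continuous_const Complex.continuous_re
    exact (hd.contDiffOn ho).contDiffAt (ho.mem_nhds (by simpa using hx))
  exact h.real_of_complex.congr_of_eventuallyEq
    (Eventually.of_forall fun y => by simp [Complex.Gamma_ofReal])

theorem hasDerivAt_realGamma {x : ℝ} (hx : 0 < x) :
    HasDerivAt Real.Gamma (deriv Real.Gamma x) x :=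
  ((contDiffAt_realGamma hx).differentiableAt one_ne_zero).hasDerivAt

theorem continuousAt_deriv_realGamma {x : ℝ} (hx : 0 < x) :
    ContinuousAt (deriv Real.Gamma) x := by
  have h : ContDiffOn ℝ 1 Real.Gamma (Ioi 0) := fun y hy =>
    (contDiffAt_realGamma hy).contDiffWithinAt
  exact (h.continuousOn_deriv_of_isOpen isOpen_Ioi le_rfl).continuousAt (Ioi_mem_nhds hx)

theorem continuousAt_realGamma {x : ℝ} (hx : 0 < x) : ContinuousAt Real.Gamma x :=
  (hasDerivAt_realGamma hx).continuousAt

/-- The partial derivative of `betaFn` in its first argument. -/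
noncomputable def betaFnDeriv (a b : ℝ) : ℝ :=
  (deriv Real.Gamma a * Real.Gamma b * Real.Gamma (a + b) -
    Real.Gamma a * Real.Gamma b * deriv Real.Gamma (a + b)) / Real.Gamma (a + b) ^ 2

theorem hasDerivAt_betaFn {a b : ℝ} (ha : 0 < a) (hb : 0 < b) :
    HasDerivAt (fun x => betaFn x b) (betaFnDeriv a b) a := by
  have hab : 0 < a + b := add_pos ha hb
  exact ((hasDerivAt_realGamma ha).mul_const _).fun_div
    ((hasDerivAt_realGamma hab).comp_add_const a b) (Real.Gamma_pos_of_pos hab).ne'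

theorem continuousAt_betaFn {p : ℝ × ℝ} (h₁ : 0 < p.1) (h₂ : 0 < p.2) :
    ContinuousAt (fun p : ℝ × ℝ => betaFn p.1 p.2) p := by
  have hab : 0 < p.1 + p.2 := add_pos h₁ h₂
  exact (((continuousAt_realGamma h₁).comp continuousAt_fst).mul
    ((continuousAt_realGamma h₂).comp continuousAt_snd)).div
    (ContinuousAt.comp (f := fun p : ℝ × ℝ => p.1 + p.2) (continuousAt_realGamma hab)
      (by fun_prop)) (Real.Gamma_pos_of_pos hab).ne'

theorem continuousAt_betaFnDeriv {p : ℝ × ℝ} (h₁ : 0 < p.1) (h₂ : 0 < p.2) :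
    ContinuousAt (fun p : ℝ × ℝ => betaFnDeriv p.1 p.2) p := by
  have hab : 0 < p.1 + p.2 := add_pos h₁ h₂
  have g₁ : ContinuousAt (fun p : ℝ × ℝ => Real.Gamma p.1) p :=
    (continuousAt_realGamma h₁).comp continuousAt_fst
  have g₂ : ContinuousAt (fun p : ℝ × ℝ => Real.Gamma p.2) p :=
    (continuousAt_realGamma h₂).comp continuousAt_snd
  have g₃ : ContinuousAt (fun p : ℝ × ℝ => Real.Gamma (p.1 + p.2)) p :=
    ContinuousAt.comp (f := fun p : ℝ × ℝ => p.1 + p.2) (continuousAt_realGamma hab) (by fun_prop)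
  have d₁ : ContinuousAt (fun p : ℝ × ℝ => deriv Real.Gamma p.1) p :=
    (continuousAt_deriv_realGamma h₁).comp continuousAt_fst
  have d₃ : ContinuousAt (fun p : ℝ × ℝ => deriv Real.Gamma (p.1 + p.2)) p :=
    ContinuousAt.comp (f := fun p : ℝ × ℝ => p.1 + p.2) (continuousAt_deriv_realGamma hab)
      (by fun_prop)
  exact (((d₁.mul g₂).mul g₃).sub ((g₁.mul g₂).mul d₃)).div (g₃.pow 2)
    (pow_ne_zero 2 (Real.Gamma_pos_of_pos hab).ne')

theorem integral_rpow_mul_rpow_eq_betaFn {a b y τ : ℝ} (ha : 0 < a) (hb : 0 < b) (hy : y < τ) :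
    ∫ s in y..τ, (τ - s) ^ (a - 1) * (s - y) ^ (b - 1) =
      betaFn a b * (τ - y) ^ (a + b - 1) := by
  have hL : 0 < τ - y := sub_pos.2 hy
  have h := Complex.betaIntegral_scaled a b hL
  rw [Complex.betaIntegral_eq_Gamma_mul_div a b (by simpa) (by simpa)] at h
  have h1 : ∫ s in y..τ, (τ - s) ^ (a - 1) * (s - y) ^ (b - 1) =
      ∫ x in (0 : ℝ)..(τ - y), x ^ (a - 1) * (τ - y - x) ^ (b - 1) := by
    have := intervalIntegral.integral_comp_sub_left
      (fun x : ℝ => x ^ (a - 1) * (τ - y - x) ^ (b - 1)) (a := y) (b := τ) τ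
    rw [sub_self] at this
    rw [← this]
    refine intervalIntegral.integral_congr fun s _ => ?_
    congr 2
    ring
  rw [h1]
  have h2 : ∫ x in (0 : ℝ)..(τ - y),
        (x : ℂ) ^ ((a : ℂ) - 1) * (((τ - y : ℝ) : ℂ) - x) ^ ((b : ℂ) - 1) =
      ((∫ x in (0 : ℝ)..(τ - y), x ^ (a - 1) * (τ - y - x) ^ (b - 1) : ℝ) : ℂ) := by
    rw [← intervalIntegral.integral_ofReal]
    refine intervalIntegral.integral_congr fun x hx => ?_
    rw [uIcc_of_le hL.le] at hx
    rw [Complex.ofReal_mul, Complex.ofReal_cpow hx.1, Complex.ofReal_cpow (sub_nonneg.2 hx.2)]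
    push_cast
    rfl
  rw [h2] at h
  apply Complex.ofReal_injective
  rw [h, betaFn, Complex.ofReal_mul, Complex.ofReal_cpow hL.le, Complex.ofReal_div,
    Complex.ofReal_mul, ← Complex.Gamma_ofReal, ← Complex.Gamma_ofReal, ← Complex.Gamma_ofReal]
  push_cast
  ring

theorem intervalIntegrable_rpow_mul_rpow {a b y τ : ℝ} (ha : 0 < a) (hb : 0 < b) (hy : y < τ) :
    IntervalIntegrable (fun s => (τ - s) ^ (a - 1) * (s - y) ^ (b - 1)) volume y τ := by
  by_contra h
  have := integral_rpow_mul_rpow_eq_betaFn ha hb hy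
  rw [intervalIntegral.integral_undef h] at this
  exact (mul_pos (betaFn_pos ha hb) (Real.rpow_pos_of_pos (sub_pos.2 hy) _)).ne this

theorem integral_rpow_mul_integral_rpow_eq {α g : ℝ → ℝ} {a τ : ℝ} (hτ : 0 < τ) (ha : 0 < a)
    (hα : ContinuousOn α (Icc 0 τ)) (hα1 : ∀ y ∈ Icc 0 τ, α y < 1)
    (hg : ContinuousOn g (Icc 0 τ))
    (hint : IntegrableOn (fun y => betaFn a (1 - α y) * (τ - y) ^ (a - α y) * g y) (Ioo 0 τ)) :
    ∫ s in (0 : ℝ)..τ, (τ - s) ^ (a - 1) * ∫ y in (0 : ℝ)..s, (s - y) ^ (-α y) * g y =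
      ∫ y in (0 : ℝ)..τ, betaFn a (1 - α y) * (τ - y) ^ (a - α y) * g y := by
  set S : Set (ℝ × ℝ) := {p | 0 < p.2 ∧ p.2 < p.1 ∧ p.1 < τ} with hS
  set k : ℝ × ℝ → ℝ := fun p => (τ - p.1) ^ (a - 1) * ((p.1 - p.2) ^ (-α p.2) * g p.2) with hk
  have hSo : IsOpen S := by
    refine (isOpen_lt continuous_const continuous_snd).inter
      ((isOpen_lt continuous_snd continuous_fst).inter (isOpen_lt continuous_fst continuous_const))
  have hkc : ContinuousOn k S := by
    have hm : MapsTo (Prod.snd : ℝ × ℝ → ℝ) S (Icc 0 τ) := fun p hp =>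
      ⟨hp.1.le, (hp.2.1.trans hp.2.2).le⟩
    refine ContinuousOn.mul ?_ (ContinuousOn.mul ?_ (hg.comp continuousOn_snd hm))
    · exact ContinuousOn.rpow_const (by fun_prop) fun p hp => Or.inl (sub_pos.2 hp.2.2).ne'
    · exact ContinuousOn.rpow (by fun_prop) (hα.comp continuousOn_snd hm).neg
        fun p hp => Or.inl (sub_pos.2 hp.2.1).ne'
  have hmeas : AEStronglyMeasurable (S.indicator k) (volume.prod volume) :=
    (aestronglyMeasurable_indicator_iff hSo.measurableSet).2
      (hkc.aestronglyMeasurable hSo.measurableSet)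
  have hsec_pos : ∀ y, 0 < y → (fun s => S.indicator k (s, y)) =
      (Ioo y τ).indicator fun s => (τ - s) ^ (a - 1) * (s - y) ^ ((1 - α y) - 1) * g y := by
    intro y hy
    funext s
    have e : (1 - α y) - 1 = -α y := by ring
    by_cases h : s ∈ Ioo y τ
    · rw [indicator_of_mem h, indicator_of_mem (show (s, y) ∈ S from ⟨hy, h.1, h.2⟩), e, mul_assoc]
    · rw [indicator_of_notMem h, indicator_of_notMem fun h' => h ⟨h'.2.1, h'.2.2⟩]
  have hsec_zero : ∀ y, y ∉ Ioo 0 τ → (fun s => S.indicator k (s, y)) = 0 := by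
    intro y hy
    funext s
    exact indicator_of_notMem (fun h' => hy ⟨h'.1, h'.2.1.trans h'.2.2⟩) _
  have hbase : ∀ y ∈ Ioo 0 τ, IntegrableOn (fun s => (τ - s) ^ (a - 1) * (s - y) ^ ((1 - α y) - 1))
      (Ioo y τ) := fun y hy => by
    have := intervalIntegrable_rpow_mul_rpow ha (sub_pos.2 (hα1 y (Ioo_subset_Icc_self hy))) hy.2
    exact ((intervalIntegrable_iff_integrableOn_Ioc_of_le hy.2.le).1 this).mono_set
      Ioo_subset_Ioc_self
  have hval : ∀ y ∈ Ioo 0 τ, ∫ s in Ioo y τ, (τ - s) ^ (a - 1) * (s - y) ^ ((1 - α y) - 1) =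
      betaFn a (1 - α y) * (τ - y) ^ (a - α y) := fun y hy => by
    rw [← integral_Ioc_eq_integral_Ioo, ← intervalIntegral.integral_of_le hy.2.le,
      integral_rpow_mul_rpow_eq_betaFn ha (sub_pos.2 (hα1 y (Ioo_subset_Icc_self hy))) hy.2]
    congr 2
    ring
  have hinner : ∀ y, ∫ s, S.indicator k (s, y) = (Ioo 0 τ).indicator
      (fun y => betaFn a (1 - α y) * (τ - y) ^ (a - α y) * g y) y := by
    intro y
    by_cases hy : y ∈ Ioo 0 τ
    · rw [indicator_of_mem hy, hsec_pos y hy.1, integral_indicator measurableSet_Ioo,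
        integral_mul_const, hval y hy]
    · rw [indicator_of_notMem hy, hsec_zero y hy]
      simp
  have hnorm : ∀ y, ∫ s, ‖S.indicator k (s, y)‖ = (Ioo 0 τ).indicator
      (fun y => ‖betaFn a (1 - α y) * (τ - y) ^ (a - α y) * g y‖) y := by
    intro y
    by_cases hy : y ∈ Ioo 0 τ
    · have hpos := betaFn_pos ha (sub_pos.2 (hα1 y (Ioo_subset_Icc_self hy)))
      have e : (fun s => ‖S.indicator k (s, y)‖) = (Ioo y τ).indicator
          fun s => (τ - s) ^ (a - 1) * (s - y) ^ ((1 - α y) - 1) * ‖g y‖ := by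
        funext s
        rw [congrFun (hsec_pos y hy.1) s, norm_indicator_eq_indicator_norm]
        refine indicator_congr (fun s hs => ?_) |> congrFun <| s
        rw [norm_mul, Real.norm_of_nonneg (mul_nonneg (Real.rpow_nonneg (sub_pos.2 hs.2).le _)
          (Real.rpow_nonneg (sub_pos.2 hs.1).le _))]
      rw [indicator_of_mem hy, e, integral_indicator measurableSet_Ioo, integral_mul_const,
        hval y hy, norm_mul, Real.norm_of_nonneg (mul_nonneg hpos.le
          (Real.rpow_nonneg (sub_pos.2 hy.2).le _))]
    · rw [indicator_of_notMem hy]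
      simp [funext_iff.1 (hsec_zero y hy)]
  have hprod : Integrable (S.indicator k) (volume.prod volume) := by
    refine (integrable_prod_iff' hmeas).2 ⟨Eventually.of_forall fun y => ?_, ?_⟩
    · by_cases hy : y ∈ Ioo 0 τ
      · rw [hsec_pos y hy.1]
        exact (integrable_indicator_iff measurableSet_Ioo).2 ((hbase y hy).mul_const _)
      · rw [hsec_zero y hy]
        exact integrable_zero _ _ _
    · simp_rw [hnorm]
      exact (integrable_indicator_iff measurableSet_Ioo).2 hint.norm
  have hswap := integral_integral_swap (f := fun s y => S.indicator k (s, y)) hprod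
  simp_rw [hinner] at hswap
  rw [integral_indicator measurableSet_Ioo] at hswap
  rw [intervalIntegral.integral_of_le hτ.le, intervalIntegral.integral_of_le hτ.le,
    integral_Ioc_eq_integral_Ioo, integral_Ioc_eq_integral_Ioo, ← hswap,
    ← integral_indicator measurableSet_Ioo]
  refine integral_congr_ae (Eventually.of_forall fun s => ?_)
  simp only
  by_cases hs : s ∈ Ioo 0 τ
  · rw [indicator_of_mem hs, intervalIntegral.integral_of_le hs.1.le, integral_Ioc_eq_integral_Ioo,
      ← integral_const_mul, ← integral_indicator measurableSet_Ioo]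
    refine integral_congr_ae (Eventually.of_forall fun y => ?_)
    simp only
    by_cases hy : y ∈ Ioo 0 s
    · rw [indicator_of_mem hy, indicator_of_mem (show (s, y) ∈ S from ⟨hy.1, hy.2, hs.2⟩)]
    · rw [indicator_of_notMem hy, indicator_of_notMem fun h' => hy ⟨h'.1, h'.2.1⟩]
  · have : ∀ y, S.indicator k (s, y) = 0 := fun y =>
      indicator_of_notMem (fun h' => hs ⟨h'.1.trans h'.2.1, h'.2.2⟩) _
    rw [indicator_of_notMem hs]
    simp [this]

/-- Leibniz rule for a Volterra integral whose kernel has a derivative with an integrable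
singularity on the diagonal, controlled through the modulus `C (√(b - y) - √(a - y))`. -/
theorem hasDerivAt_integral_volterra {Φ K : ℝ → ℝ → ℝ} {g : ℝ → ℝ} {C T t : ℝ}
    (ht : t ∈ Ioo 0 T) (hg : ContinuousOn g (Icc 0 T))
    (hΦ : ∀ y a b, 0 ≤ y → y ≤ a → a ≤ b → b ≤ T →
      |Φ y b - Φ y a| ≤ C * (√(b - y) - √(a - y)))
    (hcont : ∀ τ ≤ T, ContinuousOn (fun y => Φ y τ) (Ico 0 τ))
    (hdiag : ContinuousOn (fun y => Φ y y) (Icc 0 T))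
    (hK : ∀ y, 0 ≤ y → y < t → HasDerivAt (Φ y) (K y t) t) :
    HasDerivAt (fun τ => ∫ y in (0 : ℝ)..τ, Φ y τ * g y)
      (Φ t t * g t + ∫ y in (0 : ℝ)..t, K y t * g y) t ∧
    ∀ τ ∈ Ioo 0 T, IntervalIntegrable (fun y => Φ y τ * g y) volume 0 τ := by
  have hT : 0 < T := ht.1.trans ht.2
  have hC : 0 ≤ C := by
    have h := (abs_nonneg _).trans (hΦ 0 0 T le_rfl le_rfl hT.le le_rfl)
    simp only [sub_zero, Real.sqrt_zero] at h
    exact nonneg_of_mul_nonneg_left h (Real.sqrt_pos.2 hT)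
  obtain ⟨M, hM⟩ := isCompact_Icc.exists_bound_of_continuousOn hg
  obtain ⟨D, hD⟩ := isCompact_Icc.exists_bound_of_continuousOn hdiag
  have hM0 : 0 ≤ M := (norm_nonneg _).trans (hM 0 ⟨le_rfl, hT.le⟩)
  have hD0 : 0 ≤ D := (norm_nonneg _).trans (hD 0 ⟨le_rfl, hT.le⟩)
  set Ψ : ℝ → ℝ → ℝ := fun τ y => Φ y (max y τ) * g y with hΨ
  have hmeas : ∀ τ ∈ Icc 0 T, AEStronglyMeasurable (Ψ τ) (volume.restrict (Icc 0 T)) := by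
    intro τ hτ
    refine AEStronglyMeasurable.mul ?_ (hg.aestronglyMeasurable measurableSet_Icc)
    rw [← Ico_union_Icc_eq_Icc hτ.1 hτ.2, aestronglyMeasurable_union_iff]
    constructor
    · refine ((hcont τ hτ.2).congr fun y hy => ?_).aestronglyMeasurable measurableSet_Ico
      simp only [max_eq_right hy.2.le]
    · refine ((hdiag.mono (Icc_subset_Icc_left hτ.1)).congr fun y hy => ?_).aestronglyMeasurable
        measurableSet_Icc
      simp only [max_eq_left hy.1]
  have hdiff : ∀ τ ∈ Icc 0 T, ∀ y ∈ Icc 0 T, |Φ y (max y τ) - Φ y y| ≤ C * √(max y τ - y) := by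
    intro τ hτ y hy
    simpa using hΦ y y (max y τ) hy.1 le_rfl (le_max_left _ _) (max_le hy.2 hτ.2)
  have hbdd : ∀ τ ∈ Icc 0 T, ∀ y ∈ Icc 0 T, ‖Ψ τ y‖ ≤ (D + C * √T) * M := by
    intro τ hτ y hy
    rw [hΨ, norm_mul]
    refine mul_le_mul ?_ (hM y hy) (norm_nonneg _) (by positivity)
    have h1 := hdiff τ hτ y hy
    have h2 := hD y hy
    have h3 : √(max y τ - y) ≤ √T := Real.sqrt_le_sqrt (by linarith [max_le hy.2 hτ.2, hy.1])
    have h4 := mul_le_mul_of_nonneg_left h3 hC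
    rw [Real.norm_eq_abs] at h2 ⊢
    have h5 := abs_add_le (Φ y (max y τ) - Φ y y) (Φ y y)
    rw [sub_add_cancel] at h5
    linarith
  have hint : ∀ τ ∈ Icc 0 T, IntegrableOn (Ψ τ) (Icc 0 T) := fun τ hτ =>
    Integrable.of_bound (hmeas τ hτ) ((D + C * √T) * M)
      ((ae_restrict_iff' measurableSet_Icc).2 (Eventually.of_forall (hbdd τ hτ)))
  have hii : ∀ τ ∈ Icc 0 T, ∀ a ∈ Icc 0 T, ∀ b ∈ Icc 0 T, IntervalIntegrable (Ψ τ) volume a b :=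
    fun τ hτ a ha b hb => (intervalIntegrable_iff.2
      ((hint τ hτ).mono_set (uIoc_subset_uIcc.trans (ordConnected_Icc.uIcc_subset ha hb))))
  have h0 : (0 : ℝ) ∈ Icc 0 T := ⟨le_rfl, hT.le⟩
  have htI : t ∈ Icc 0 T := Ioo_subset_Icc_self ht
  have hΨeq : ∀ τ, 0 ≤ τ → ∀ y ∈ uIcc 0 τ, Ψ τ y = Φ y τ * g y := by
    intro τ hτ y hy
    rw [uIcc_of_le hτ] at hy
    simp only [hΨ, max_eq_right hy.2]
  refine ⟨?_, fun τ hτ => ?_⟩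
  swap
  · have hτ' := Ioo_subset_Icc_self hτ
    exact (hii τ hτ' 0 h0 τ hτ').congr fun y hy => hΨeq τ hτ.1.le y (uIoc_subset_uIcc hy)
  have hsplit : (fun τ => ∫ y in (0 : ℝ)..τ, Φ y τ * g y) =ᶠ[𝓝 t]
      fun τ => (∫ y in t..τ, Ψ τ y) + ∫ y in Ioc 0 t, Ψ τ y := by
    filter_upwards [Ioo_mem_nhds ht.1 ht.2] with τ hτ
    have hτ' := Ioo_subset_Icc_self hτ
    rw [← intervalIntegral.integral_of_le ht.1.le, add_comm,
      intervalIntegral.integral_add_adjacent_intervals (hii τ hτ' 0 h0 t htI)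
        (hii τ hτ' t htI τ hτ')]
    exact intervalIntegral.integral_congr fun y hy => (hΨeq τ hτ.1.le y hy).symm
  refine HasDerivAt.congr_of_eventuallyEq (HasDerivAt.fun_add ?_ ?_) hsplit
  · rw [hasDerivAt_iff_isLittleO, Asymptotics.isLittleO_iff]
    intro ε hε
    have hlim : Tendsto (fun τ => C * √|τ - t| * M) (𝓝 t) (𝓝 0) := by
      have : ContinuousAt (fun τ => C * √|τ - t| * M) t := by fun_prop
      simpa [ContinuousAt] using this
    have hdg : ContinuousAt (fun y => Φ y y * g y) t :=
      ((hdiag.mul hg).continuousAt (Icc_mem_nhds ht.1 ht.2))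
    obtain ⟨δ, hδ, hδ'⟩ := Metric.continuousAt_iff.1 hdg (ε / 2) (half_pos hε)
    filter_upwards [Ioo_mem_nhds ht.1 ht.2, hlim.eventually_lt_const (half_pos hε),
      Metric.ball_mem_nhds t hδ] with τ hτ hτ1 hτ2
    have hτ' := Ioo_subset_Icc_self hτ
    rw [intervalIntegral.integral_same, sub_zero, smul_eq_mul, ← smul_eq_mul,
      ← intervalIntegral.integral_const, ← intervalIntegral.integral_sub (hii τ hτ' t htI τ hτ')
        intervalIntegrable_const]
    refine intervalIntegral.norm_integral_le_of_norm_le_const fun y hy => ?_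
    have hyI : y ∈ Icc 0 T := ordConnected_Icc.uIcc_subset htI hτ' (uIoc_subset_uIcc hy)
    have hyt : |y - t| ≤ |τ - t| := abs_sub_left_of_mem_uIcc (uIoc_subset_uIcc hy)
    have hmax : max y τ - y ≤ |τ - t| := by
      rcases le_total y τ with h | h
      · rw [max_eq_right h]
        rcases le_total t τ with h' | h'
        · have := (uIcc_of_le h' ▸ uIoc_subset_uIcc hy).1
          rw [abs_of_nonneg (sub_nonneg.2 h')]
          linarith
        · have := (uIcc_of_ge h' ▸ uIoc_subset_uIcc hy).1
          have h3 := abs_nonneg (τ - t)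
          linarith
      · rw [max_eq_left h, sub_self]
        exact abs_nonneg _
    have e1 : |Φ y (max y τ) - Φ y y| * |g y| ≤ C * √|τ - t| * M :=
      mul_le_mul ((hdiff τ hτ' y hyI).trans
        (mul_le_mul_of_nonneg_left (Real.sqrt_le_sqrt hmax) hC)) (hM y hyI) (abs_nonneg _)
        (by positivity)
    have e2 := hδ' (x := y) (by
      rw [Metric.mem_ball, Real.dist_eq] at hτ2
      rw [Real.dist_eq]
      exact hyt.trans_lt hτ2)
    rw [Real.dist_eq] at e2
    rw [Real.norm_eq_abs, hΨ]
    rw [← abs_mul] at e1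
    calc |Φ y (max y τ) * g y - Φ t t * g t|
        = |(Φ y (max y τ) - Φ y y) * g y + (Φ y y * g y - Φ t t * g t)| := by ring_nf
      _ ≤ _ := abs_add_le _ _
      _ ≤ ε := by linarith
  · have hsub : Ioc 0 t ⊆ Icc 0 T := fun y hy => ⟨hy.1.le, hy.2.trans ht.2.le⟩
    have hlip : ∀ y ∈ Ioo 0 t, ∀ τ ∈ Icc 0 T,
        |Φ y (max y τ) - Φ y t| ≤ C * (t - y) ^ (-(1 / 2) : ℝ) * |τ - t| := by
      intro y hy τ hτ
      have key : ∀ p q, 0 ≤ p → p ≤ q → 0 < t - y → t - y ≤ q →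
          √q - √p ≤ (t - y) ^ (-(1 / 2) : ℝ) * (q - p) := by
        intro p q hp hpq hty hq
        have hs : 0 < √(t - y) := Real.sqrt_pos.2 hty
        rw [Real.rpow_neg hty.le, ← Real.sqrt_eq_rpow, inv_mul_eq_div, le_div_iff₀ hs]
        have h1 : √(t - y) ≤ √q := Real.sqrt_le_sqrt hq
        have h2 : √p ≤ √q := Real.sqrt_le_sqrt hpq
        nlinarith [Real.sq_sqrt hp, Real.sq_sqrt (hp.trans hpq), Real.sqrt_nonneg p]
      have hty : 0 < t - y := sub_pos.2 hy.2
      rcases le_total (max y τ) t with h | h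
      · rw [abs_sub_comm, mul_assoc]
        refine (hΦ y (max y τ) t hy.1.le (le_max_left _ _) h ht.2.le).trans
          (mul_le_mul_of_nonneg_left ?_ hC)
        refine (key _ _ (sub_nonneg.2 (le_max_left _ _)) (by linarith) hty le_rfl).trans
          (mul_le_mul_of_nonneg_left ?_ (Real.rpow_nonneg hty.le _))
        rw [abs_sub_comm]
        refine le_trans ?_ (le_abs_self _)
        linarith [le_max_right y τ]
      · rw [mul_assoc]
        have hm : max y τ = τ := by
          rcases max_choice y τ with h' | h'
          · rw [h'] at h
            exact absurd hy.2 h.not_gt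
          · exact h'
        rw [hm] at h ⊢
        refine (hΦ y t τ hy.1.le hy.2.le h hτ.2).trans (mul_le_mul_of_nonneg_left ?_ hC)
        refine (key _ _ hty.le (by linarith) hty (by linarith)).trans
          (mul_le_mul_of_nonneg_left ?_ (Real.rpow_nonneg hty.le _))
        refine le_trans ?_ (le_abs_self _)
        linarith
    have hae : ∀ {P : ℝ → Prop}, (∀ y ∈ Ioo 0 t, P y) → ∀ᵐ y ∂volume.restrict (Ioc 0 t), P y := by
      intro P h
      rw [← restrict_Ioo_eq_restrict_Ioc]
      exact (ae_restrict_iff' measurableSet_Ioo).2 (Eventually.of_forall h)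
    have hder : ∀ y ∈ Ioo 0 t, HasDerivAt (fun τ => Ψ τ y) (K y t * g y) t := by
      intro y hy
      refine ((hK y hy.1.le hy.2).mul_const (g y)).congr_of_eventuallyEq ?_
      filter_upwards [lt_mem_nhds hy.2] with τ hτ
      simp only [hΨ, max_eq_right (le_of_lt hτ)]
    have hΨm : ∀ τ ∈ Icc 0 T, AEStronglyMeasurable (Ψ τ) (volume.restrict (Ioc 0 t)) :=
      fun τ hτ => (hmeas τ hτ).mono_set hsub
    have hKm : AEStronglyMeasurable (fun y => K y t * g y) (volume.restrict (Ioc 0 t)) := by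
      set u : ℕ → ℝ := fun n => t + (T - t) * (1 / ((n : ℝ) + 1)) with hu
      have hTt : 0 < T - t := sub_pos.2 ht.2
      have hu_gt : ∀ n, t < u n := fun n => by
        have : 0 < (T - t) * (1 / ((n : ℝ) + 1)) := by positivity
        simp only [hu]
        linarith
      have hu_le : ∀ n, u n ≤ T := fun n => by
        have h1 : 1 / ((n : ℝ) + 1) ≤ 1 := by
          rw [div_le_one (by positivity)]
          linarith [(Nat.cast_nonneg n : (0 : ℝ) ≤ n)]
        have := mul_le_mul_of_nonneg_left h1 hTt.le
        simp only [hu]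
        linarith
      have hu_lim : Tendsto u atTop (𝓝[≠] t) := by
        refine tendsto_nhdsWithin_iff.2 ⟨?_, Eventually.of_forall fun n => (hu_gt n).ne'⟩
        simpa [hu] using (tendsto_one_div_add_atTop_nhds_zero_nat.const_mul (T - t)).const_add t
      refine aestronglyMeasurable_of_tendsto_ae atTop
        (f := fun n y => (u n - t)⁻¹ * (Ψ (u n) y - Ψ t y)) (fun n => ?_) (hae fun y hy => ?_)
      · exact ((hΨm (u n) ⟨ht.1.le.trans (hu_gt n).le, hu_le n⟩).sub (hΨm t htI)).const_mul _
      · exact (hasDerivAt_iff_tendsto_slope.1 (hder y hy)).comp hu_lim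
    have hb : IntegrableOn (fun y => C * (t - y) ^ (-(1 / 2) : ℝ) * M) (Ioc 0 t) := by
      have h1 : IntervalIntegrable (fun x : ℝ => x ^ (-(1 / 2) : ℝ)) volume 0 t :=
        intervalIntegral.intervalIntegrable_rpow' (by norm_num)
      have h2 := (h1.comp_sub_left t).symm
      simp only [sub_zero, sub_self] at h2
      exact (((intervalIntegrable_iff_integrableOn_Ioc_of_le ht.1.le).1 h2).const_mul C).mul_const M
    have hmain := hasFDerivAt_integral_of_dominated_loc_of_lip' (𝕜 := ℝ)
      (μ := volume.restrict (Ioc 0 t)) (F := Ψ) (x₀ := t) (s := Icc 0 T)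
      (F' := fun y => ContinuousLinearMap.toSpanSingleton ℝ (K y t * g y))
      (bound := fun y => C * (t - y) ^ (-(1 / 2) : ℝ) * M) (Icc_mem_nhds ht.1 ht.2)
      hΨm ((hint t htI).mono_set hsub)
      ((ContinuousLinearMap.toSpanSingletonCLE
        (𝕜 := ℝ) (E := ℝ)).continuous.comp_aestronglyMeasurable hKm)
      (hae fun y hy τ hτ => ?_) hb (hae fun y hy => (hder y hy).hasFDerivAt)
    · have h2 := hmain.2.hasDerivAt
      have hKi : Integrable (fun y => K y t * g y) (volume.restrict (Ioc 0 t)) := by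
        simpa using hmain.1.apply_continuousLinearMap 1
      rw [ContinuousLinearMap.integral_apply hmain.1] at h2
      simpa [intervalIntegral.integral_of_le ht.1.le] using h2
    · rw [hΨ]
      simp only [max_eq_right hy.2.le, Real.norm_eq_abs]
      rw [← sub_mul, abs_mul]
      have := mul_le_mul (hlip y hy τ hτ) (hM y ⟨hy.1.le, hy.2.le.trans ht.2.le⟩) (norm_nonneg _)
        (by have := Real.rpow_nonneg (sub_pos.2 hy.2).le (-(1 / 2)); positivity)
      rw [Real.norm_eq_abs] at this
      linarith

theorem abs_sub_le_sqrt_sub_sqrt {F F' : ℝ → ℝ} {C y T : ℝ} (hF : ContinuousOn F (Icc y T))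
    (hF' : ∀ r ∈ Ioo y T, HasDerivAt F (F' r) r)
    (hC : ∀ r ∈ Ioo y T, |F' r| * √(r - y) ≤ C / 2) {a b : ℝ}
    (hya : y ≤ a) (hab : a ≤ b) (hbT : b ≤ T) :
    |F b - F a| ≤ C * (√(b - y) - √(a - y)) := by
  have hmono : ∀ σ : ℝ, |σ| = 1 → MonotoneOn (fun r => C * √(r - y) + σ * F r) (Icc y T) := by
    intro σ hσ
    have hd : ∀ r ∈ interior (Icc y T), HasDerivAt (fun r => C * √(r - y) + σ * F r)
        (C * (1 / (2 * √(r - y))) + σ * F' r) r := by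
      intro r hr
      rw [interior_Icc] at hr
      exact ((((hasDerivAt_id r).sub_const y).sqrt (sub_pos.2 hr.1).ne').const_mul C).add
        ((hF' r hr).const_mul σ)
    refine monotoneOn_of_deriv_nonneg (convex_Icc y T)
      (ContinuousOn.add (by fun_prop) (hF.const_mul σ))
      (fun r hr => (hd r hr).differentiableAt.differentiableWithinAt) fun r hr => ?_
    rw [(hd r hr).deriv]
    rw [interior_Icc] at hr
    have hs : 0 < √(r - y) := Real.sqrt_pos.2 (sub_pos.2 hr.1)
    have h1 : |F' r| ≤ C * (1 / (2 * √(r - y))) := by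
      calc |F' r| ≤ C / 2 / √(r - y) := (le_div_iff₀ hs).2 (hC r hr)
        _ = _ := by field_simp
    have h2 : |σ * F' r| = |F' r| := by rw [abs_mul, hσ, one_mul]
    linarith [neg_abs_le (σ * F' r)]
  have ha : a ∈ Icc y T := ⟨hya, hab.trans hbT⟩
  have hb : b ∈ Icc y T := ⟨hya.trans hab, hbT⟩
  have h1 := hmono 1 (by simp) ha hb hab
  have h2 := hmono (-1) (by simp) ha hb hab
  simp only at h1 h2
  rw [abs_le]
  constructor <;> linarith

/-- The kernel `B(α(τ), 1 - α(y)) (τ - y) ^ (α(τ) - α(y))`. -/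
noncomputable def abelKernel (α : ℝ → ℝ) (y τ : ℝ) : ℝ :=
  betaFn (α τ) (1 - α y) * (τ - y) ^ (α τ - α y)

theorem abelKernel_eq_exp (α : ℝ → ℝ) {y τ : ℝ} (h : y ≤ τ) :
    abelKernel α y τ =
      betaFn (α τ) (1 - α y) * Real.exp (Real.log (τ - y) * (α τ - α y)) := by
  rcases h.eq_or_lt with rfl | h
  · simp [abelKernel]
  · rw [abelKernel, Real.rpow_def_of_pos (sub_pos.2 h)]

theorem hasDerivAt_abelKernel {α : ℝ → ℝ} {y r d : ℝ} (hy : α y < 1) (hr : 0 < α r)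
    (hyr : y < r) (hd : HasDerivAt α d r) :
    HasDerivAt (abelKernel α y)
      (betaFnDeriv (α r) (1 - α y) * d * (r - y) ^ (α r - α y) +
        betaFn (α r) (1 - α y) * (1 * (α r - α y) * (r - y) ^ (α r - α y - 1) +
          d * (r - y) ^ (α r - α y) * Real.log (r - y))) r :=
  ((hasDerivAt_betaFn hr (sub_pos.2 hy)).comp r hd).mul
    (((hasDerivAt_id r).sub_const y).rpow (hd.sub_const (α y)) (sub_pos.2 hyr))

theorem exists_abelKernel_sqrt_modulus {T αlo αhi : ℝ} (hT : 0 < T) {α : ℝ → ℝ}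
    (hα : ContDiffOn ℝ 1 α (Icc 0 T)) (hlo : 0 < αlo) (hhi : αhi < 1)
    (hbound : ∀ t ∈ Icc 0 T, αlo ≤ α t ∧ α t ≤ αhi) :
    ∃ C, ∀ y a b, 0 ≤ y → y ≤ a → a ≤ b → b ≤ T →
      |abelKernel α y b - abelKernel α y a| ≤ C * (√(b - y) - √(a - y)) := by
  have hαd : DifferentiableOn ℝ α (Icc 0 T) := hα.differentiableOn one_ne_zero
  have hα' : ContinuousOn (derivWithin α (Icc 0 T)) (Icc 0 T) :=
    hα.continuousOn_derivWithin (uniqueDiffOn_Icc hT) le_rfl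
  obtain ⟨L, hL⟩ := isCompact_Icc.exists_bound_of_continuousOn hα'
  have hL0 : 0 ≤ L := (norm_nonneg _).trans (hL 0 ⟨le_rfl, hT.le⟩)
  have hLip : ∀ y ∈ Icc 0 T, ∀ r ∈ Icc 0 T, |α r - α y| ≤ L * |r - y| := fun y hy r hr =>
    (convex_Icc 0 T).norm_image_sub_le_of_norm_derivWithin_le hαd hL hy hr
  have hpos : ∀ p ∈ Icc αlo αhi ×ˢ Icc (1 - αhi) (1 - αlo), 0 < p.1 ∧ 0 < p.2 := fun p hp =>
    ⟨hlo.trans_le hp.1.1, (sub_pos.2 hhi).trans_le hp.2.1⟩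
  have hR : IsCompact (Icc αlo αhi ×ˢ Icc (1 - αhi) (1 - αlo)) := isCompact_Icc.prod isCompact_Icc
  obtain ⟨B, hB⟩ := hR.exists_bound_of_continuousOn (f := fun p => betaFn p.1 p.2) fun p hp =>
    (continuousAt_betaFn (hpos p hp).1 (hpos p hp).2).continuousWithinAt
  obtain ⟨B', hB'⟩ := hR.exists_bound_of_continuousOn (f := fun p => betaFnDeriv p.1 p.2)
    fun p hp => (continuousAt_betaFnDeriv (hpos p hp).1 (hpos p hp).2).continuousWithinAt
  obtain ⟨P, hP⟩ := (isCompact_Icc (a := 0) (b := T)).exists_bound_of_continuousOn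
    Real.continuous_mul_log.continuousOn
  obtain ⟨Q, hQ⟩ := (isCompact_Icc (a := 0) (b := T)).exists_bound_of_continuousOn
    (Real.continuous_mul_log.comp Real.continuous_sqrt).continuousOn
  have hmem : ∀ y ∈ Icc 0 T, ∀ r ∈ Icc 0 T,
      (α r, 1 - α y) ∈ Icc αlo αhi ×ˢ Icc (1 - αhi) (1 - αlo) := fun y hy r hr =>
    ⟨hbound r hr, by linarith [(hbound y hy).2], by linarith [(hbound y hy).1]⟩
  have h0 : (0 : ℝ) ∈ Icc 0 T := ⟨le_rfl, hT.le⟩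
  have hB0 : 0 ≤ B := (norm_nonneg _).trans (hB _ (hmem 0 h0 0 h0))
  have hB'0 : 0 ≤ B' := (norm_nonneg _).trans (hB' _ (hmem 0 h0 0 h0))
  set E := Real.exp (L * P) with hE
  have hE0 : 0 < E := Real.exp_pos _
  refine ⟨2 * ((B' * L * E + B * (L * E)) * √T + B * (L * E * (2 * Q))), ?_⟩
  intro y a b hy hya hab hbT
  have hyI : y ∈ Icc 0 T := ⟨hy, hya.trans (hab.trans hbT)⟩
  refine abs_sub_le_sqrt_sub_sqrt (T := T)
    (F' := fun r => betaFnDeriv (α r) (1 - α y) * derivWithin α (Icc 0 T) r *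
      (r - y) ^ (α r - α y) + betaFn (α r) (1 - α y) * (1 * (α r - α y) *
      (r - y) ^ (α r - α y - 1) +
      derivWithin α (Icc 0 T) r * (r - y) ^ (α r - α y) * Real.log (r - y))) ?_ ?_ ?_ hya hab hbT
  · have hsub : Icc y T ⊆ Icc 0 T := Icc_subset_Icc_left hy
    have hαc : ContinuousOn α (Icc y T) := hα.continuousOn.mono hsub
    refine ContinuousOn.congr (f := fun r => betaFn (α r) (1 - α y) *
      Real.exp (Real.log (r - y) * (α r - α y))) ?_ fun r hr => abelKernel_eq_exp α hr.1
    refine ContinuousOn.mul (fun r hr => ?_) (Real.continuous_exp.comp_continuousOn fun r hr => ?_)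
    · have hp := hpos _ (hmem y hyI r (hsub hr))
      exact ContinuousAt.comp_continuousWithinAt (f := fun r => (α r, 1 - α y))
        (continuousAt_betaFn hp.1 hp.2) ((hαc r hr).prodMk continuousWithinAt_const)
    · rcases hr.1.eq_or_lt with rfl | h
      · rw [ContinuousWithinAt, sub_self, Real.log_zero, zero_mul]
        have hz : Tendsto (fun r => L * |(r - y) * Real.log (r - y)|) (𝓝[Icc y T] y) (𝓝 0) := by
          have : Continuous fun r => L * |(r - y) * Real.log (r - y)| :=
            ((Real.continuous_mul_log.comp (continuous_sub_right y)).abs).const_mul L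
          simpa using (this.tendsto y).mono_left nhdsWithin_le_nhds
        refine squeeze_zero_norm' ?_ hz
        filter_upwards [self_mem_nhdsWithin] with r hr
        rw [Real.norm_eq_abs, abs_mul, abs_mul, mul_comm, ← mul_assoc]
        exact mul_le_mul_of_nonneg_right (hLip y hyI r (hsub hr)) (abs_nonneg _)
      · have hlog : ContinuousWithinAt (fun r => Real.log (r - y)) (Icc y T) r :=
          ContinuousWithinAt.log (by fun_prop) (sub_pos.2 h).ne'
        exact hlog.mul ((hαc r hr).sub continuousWithinAt_const)
  · intro r hr
    have hr' : r ∈ Ioo 0 T := ⟨hy.trans_lt hr.1, hr.2⟩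
    have hrI := Ioo_subset_Icc_self hr'
    have hn := Icc_mem_nhds hr'.1 hr'.2
    refine hasDerivAt_abelKernel ((hbound y hyI).2.trans_lt hhi)
      (hlo.trans_le (hbound r hrI).1) hr.1 ?_
    rw [derivWithin_of_mem_nhds hn]
    exact (hαd.differentiableAt hn).hasDerivAt
  · intro r hr
    have hrI : r ∈ Icc 0 T := ⟨hy.trans hr.1.le, hr.2.le⟩
    have hx : 0 < r - y := sub_pos.2 hr.1
    have hxT : r - y ≤ T := by linarith [hr.2]
    have hxI : r - y ∈ Icc 0 T := ⟨hx.le, hxT⟩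
    have hsT : √(r - y) ≤ √T := Real.sqrt_le_sqrt hxT
    have hlip := hLip y hyI r hrI
    rw [abs_of_pos hx] at hlip
    have bB := hB _ (hmem y hyI r hrI)
    have bB' := hB' _ (hmem y hyI r hrI)
    have bL := hL r hrI
    have bP := hP _ hxI
    have bQ : √(r - y) * |Real.log (r - y)| ≤ 2 * Q := by
      have := hQ _ hxI
      rw [Function.comp_apply, Real.log_sqrt hx.le, norm_mul,
        Real.norm_of_nonneg (Real.sqrt_nonneg _), Real.norm_eq_abs, abs_div,
        abs_of_pos (two_pos : (0 : ℝ) < 2)] at this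
      linarith
    simp only [Real.norm_eq_abs] at bB bB' bL bP
    generalize betaFn (α r) (1 - α y) = β at *
    generalize betaFnDeriv (α r) (1 - α y) = β' at *
    generalize derivWithin α (Icc 0 T) r = d at *
    set x := r - y with hxdef
    set z := α r - α y with hzdef
    have bE : x ^ z ≤ E := by
      rw [Real.rpow_def_of_pos hx, hE, Real.exp_le_exp]
      refine (le_abs_self _).trans ?_
      rw [abs_mul] at bP ⊢
      rw [abs_of_pos hx] at bP
      calc |Real.log x| * |z| ≤ |Real.log x| * (L * x) := by gcongr
        _ = L * (x * |Real.log x|) := by ring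
        _ ≤ _ := by gcongr
    have hE' : 0 < x ^ z := Real.rpow_pos_of_pos hx _
    have bz : |z| * x ^ (z - 1) ≤ L * E := by
      rw [Real.rpow_sub_one hx.ne', mul_div_assoc', div_le_iff₀ hx]
      calc |z| * x ^ z ≤ (L * x) * E := by gcongr
        _ = _ := by ring
    have hE1 : 0 < x ^ (z - 1) := Real.rpow_pos_of_pos hx _
    have hs0 := Real.sqrt_nonneg x
    calc |β' * d * x ^ z + β * (1 * z * x ^ (z - 1) + d * x ^ z * Real.log x)| * √x
        ≤ (|β'| * |d| * x ^ z + |β| * (|z| * x ^ (z - 1) + |d| * x ^ z * |Real.log x|)) * √x := by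
          gcongr
          refine (abs_add_le _ _).trans ?_
          rw [abs_mul, abs_mul, abs_of_pos hE', abs_mul β]
          gcongr
          refine (abs_add_le _ _).trans ?_
          rw [one_mul, abs_mul z, abs_of_pos hE1, abs_mul, abs_mul, abs_of_pos hE']
      _ = (|β'| * |d| * x ^ z + |β| * (|z| * x ^ (z - 1))) * √x +
          |β| * (|d| * x ^ z * (√x * |Real.log x|)) := by ring
      _ ≤ (B' * L * E + B * (L * E)) * √T + B * (L * E * (2 * Q)) := by gcongr
      _ = _ := by ring

/-- Approximate inversion: `D̂^{α(t)} I^{α(t)} g(t) = γ(t) g(t) + ∫_0^t K(s,t) g(s) ds`,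
where `γ(t) = Γ(α(t))Γ(1-α(t))` and `K(s,t) = ∂_t (B(α(t),1-α(s)) (t-s)^{α(t)-α(s)})`. -/
theorem abel_approximate_inversion_deriv
    (T : ℝ) (hT : 0 < T) (α : ℝ → ℝ) (αlo αhi : ℝ)
    (hα : ContDiffOn ℝ 1 α (Icc 0 T))
    (hlo : 0 < αlo) (hhi : αhi < 1)
    (hbound : ∀ t ∈ Icc 0 T, αlo ≤ α t ∧ α t ≤ αhi)
    (g : ℝ → ℝ) (hg : ContinuousOn g (Icc 0 T))
    (K : ℝ → ℝ → ℝ)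
    (hK : ∀ s t : ℝ, 0 ≤ s → s < t → t ≤ T →
      HasDerivAt (fun τ => betaFn (α τ) (1 - α s) * (τ - s) ^ (α τ - α s)) (K s t) t)
    (t : ℝ) (ht : t ∈ Ioo 0 T) :
    HasDerivAt
      (fun τ => ∫ s in (0:ℝ)..τ, (τ - s) ^ (α τ - 1) * ∫ y in (0:ℝ)..s, (s - y) ^ (-α y) * g y)
      (Real.Gamma (α t) * Real.Gamma (1 - α t) * g t + ∫ s in (0:ℝ)..t, K s t * g s) t := by
  have hαc : ContinuousOn α (Icc 0 T) := hα.continuousOn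
  have hpos : ∀ y ∈ Icc 0 T, 0 < α y := fun y hy => hlo.trans_le (hbound y hy).1
  have hlt : ∀ y ∈ Icc 0 T, α y < 1 := fun y hy => (hbound y hy).2.trans_lt hhi
  obtain ⟨C, hC⟩ := exists_abelKernel_sqrt_modulus hT hα hlo hhi hbound
  have hcont : ∀ τ ≤ T, ContinuousOn (fun y => abelKernel α y τ) (Ico 0 τ) := by
    intro τ hτT y hy
    have hsub : Ico 0 τ ⊆ Icc 0 T := fun y hy => ⟨hy.1, hy.2.le.trans hτT⟩
    have hτ : τ ∈ Icc 0 T := ⟨hy.1.trans hy.2.le, hτT⟩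
    have hαy : ContinuousWithinAt α (Ico 0 τ) y := hαc.mono hsub y hy
    refine ContinuousWithinAt.mul ?_ (ContinuousWithinAt.rpow (by fun_prop)
      (continuousWithinAt_const.sub hαy) (Or.inl (sub_pos.2 hy.2).ne'))
    exact ContinuousAt.comp_continuousWithinAt (f := fun y => (α τ, 1 - α y))
      (continuousAt_betaFn (hpos τ hτ) (sub_pos.2 (hlt y (hsub hy))))
      (continuousWithinAt_const.prodMk (continuousWithinAt_const.sub hαy))
  have hdiag : ContinuousOn (fun y => abelKernel α y y) (Icc 0 T) := by
    intro y hy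
    simp only [abelKernel, sub_self, Real.rpow_zero, mul_one]
    exact ContinuousAt.comp_continuousWithinAt (f := fun y => (α y, 1 - α y))
      (continuousAt_betaFn (hpos y hy) (sub_pos.2 (hlt y hy)))
      ((hαc y hy).prodMk (continuousWithinAt_const.sub (hαc y hy)))
  obtain ⟨hderiv, hint⟩ := hasDerivAt_integral_volterra ht hg hC hcont hdiag
    fun y hy hyt => hK y t hy hyt ht.2.le
  have hγ : abelKernel α t t = Real.Gamma (α t) * Real.Gamma (1 - α t) := by
    simp [abelKernel, betaFn]
  rw [hγ] at hderiv
  refine hderiv.congr_of_eventuallyEq ?_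
  filter_upwards [Ioo_mem_nhds ht.1 ht.2] with τ hτ
  have hsub : Icc 0 τ ⊆ Icc 0 T := Icc_subset_Icc_right hτ.2.le
  exact integral_rpow_mul_integral_rpow_eq hτ.1 (hpos τ (Ioo_subset_Icc_self hτ))
    (hαc.mono hsub) (fun y hy => hlt y (hsub hy)) (hg.mono hsub)
    (((intervalIntegrable_iff_integrableOn_Ioc_of_le hτ.1.le).1 (hint τ hτ)).mono_set
      Ioo_subset_Ioc_self)
end

section
/- Let $T>0$ and let $\alpha\in C^1[0,T]$ satisfy $0<\alpha_*\le\alpha(t)\le\alpha^*<1$ on $[0,T]$. Let $g:[0,T]\to\mathbb{R}$ be continuous. Then for every $t\in(0,T)$ the function $\tau\mapsto \int_0^\tau g(y)\big(\int_0^1 (1-z)^{\alpha((\tau-y)z+y)-1}\, z^{-\alpha((\tau-y)z+y)}\,dz\big)dy$ is differentiable at $t$ with derivative $\gamma(t)\,g(t)+\int_0^t \mathcal L(s,t)\,g(s)\,ds$, where $\gamma(t)=\Gamma(\alpha(t))\Gamma(1-\alpha(t))$ and $\mathcal L(s,t)=\partial_t\int_0^1 (1-z)^{\alpha((t-s)z+s)-1}\,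 z^{-\alpha((t-s)z+s)}\,dz$. -/
open Set MeasureTheory Filter
open scoped Topology

/-- Real form of the convergence of the Beta integral. -/
lemma intervalIntegrable_one_sub_rpow_mul_rpow {p q : ℝ} (hp : -1 < p) (hq : -1 < q) :
    IntervalIntegrable (fun z : ℝ => (1 - z) ^ p * z ^ q) volume 0 1 := by
  have h := (Complex.betaIntegral_convergent (u := ((q + 1 : ℝ) : ℂ)) (v := ((p + 1 : ℝ) : ℂ))
    (by rw [Complex.ofReal_re]; linarith) (by rw [Complex.ofReal_re]; linarith)).norm
  refine h.congr fun z hz => ?_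
  rw [uIoc_of_le zero_le_one] at hz
  have h0 : 0 ≤ z := hz.1.le
  have h1 : 0 ≤ 1 - z := sub_nonneg.2 hz.2
  have e1 : (z : ℂ) ^ (((q + 1 : ℝ) : ℂ) - 1) = ((z ^ q : ℝ) : ℂ) := by
    rw [Complex.ofReal_cpow h0]; simp
  have e2 : (1 - (z : ℂ)) ^ (((p + 1 : ℝ) : ℂ) - 1) = (((1 - z) ^ p : ℝ) : ℂ) := by
    rw [Complex.ofReal_cpow h1]; simp
  simp only [e1, e2]
  rw [← Complex.ofReal_mul, Complex.norm_real, Real.norm_of_nonneg (by positivity), mul_comm]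

lemma integral_one_sub_rpow_mul_rpow_neg {a : ℝ} (h0 : 0 < a) (h1 : a < 1) :
    ∫ z in (0:ℝ)..1, (1 - z) ^ (a - 1) * z ^ (-a) = Real.Gamma a * Real.Gamma (1 - a) := by
  have h := Complex.Gamma_mul_Gamma_eq_betaIntegral (s := ((1 - a : ℝ) : ℂ)) (t := (a : ℂ))
    (by rw [Complex.ofReal_re]; linarith) (by rwa [Complex.ofReal_re])
  have hb : Complex.betaIntegral ((1 - a : ℝ) : ℂ) (a : ℂ)
      = ((∫ z in (0:ℝ)..1, (1 - z) ^ (a - 1) * z ^ (-a) : ℝ) : ℂ) := by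
    rw [Complex.betaIntegral, ← intervalIntegral.integral_ofReal]
    refine intervalIntegral.integral_congr fun z hz => ?_
    rw [uIcc_of_le zero_le_one] at hz
    have e0 : 0 ≤ z := hz.1
    have e1 : 0 ≤ 1 - z := sub_nonneg.2 hz.2
    simp only [Complex.ofReal_mul]
    rw [Complex.ofReal_cpow e0, Complex.ofReal_cpow e1, mul_comm]
    push_cast
    congr 2
    ring
  rw [hb, ← Complex.ofReal_add, sub_add_cancel, Complex.ofReal_one, Complex.Gamma_one, one_mul,
    Complex.Gamma_ofReal, Complex.Gamma_ofReal] at h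
  rw [mul_comm]
  exact_mod_cast h.symm

lemma abs_log_le_rpow_neg_div {x ε : ℝ} (h0 : 0 < x) (h1 : x ≤ 1) (hε : 0 < ε) :
    |Real.log x| ≤ 1 / ε * x ^ (-ε) := by
  have h := (Real.abs_log_mul_self_rpow_lt x ε h0 h1 hε).le
  have hx : 0 < x ^ ε := Real.rpow_pos_of_pos h0 ε
  rw [abs_mul, abs_of_pos hx] at h
  rwa [Real.rpow_neg h0.le, ← div_eq_mul_inv, le_div_iff₀ hx]

lemma one_sub_rpow_mul_rpow_neg_le {lo hi a z : ℝ} (ha : a ∈ Icc lo hi) (hz : z ∈ Ioo (0:ℝ) 1) :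
    (1 - z) ^ (a - 1) * z ^ (-a) ≤ (1 - z) ^ (lo - 1) * z ^ (-hi) := by
  have h0 : 0 < z := hz.1
  have h1 : 0 < 1 - z := sub_pos.2 hz.2
  refine mul_le_mul (Real.rpow_le_rpow_of_exponent_ge h1 (by linarith) (by linarith [ha.1]))
    (Real.rpow_le_rpow_of_exponent_ge h0 hz.2.le (by linarith [ha.2])) (by positivity)
    (by positivity)

lemma abs_sub_one_sub_rpow_mul_rpow_neg_le {lo hi ε a b z : ℝ} (hε : 0 < ε) (ha : a ∈ Icc lo hi)
    (hb : b ∈ Icc lo hi) (hz : z ∈ Ioo (0:ℝ) 1) :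
    |(1 - z) ^ (a - 1) * z ^ (-a) - (1 - z) ^ (b - 1) * z ^ (-b)|
      ≤ 2 / ε * ((1 - z) ^ (lo - 1 - ε) * z ^ (-hi - ε)) * |a - b| := by
  have h0 : 0 < z := hz.1
  have h1 : 0 < 1 - z := sub_pos.2 hz.2
  have hderiv : ∀ x ∈ Icc lo hi, HasDerivWithinAt (fun x => (1 - z) ^ (x - 1) * z ^ (-x))
      ((1 - z) ^ (x - 1) * z ^ (-x) * (Real.log (1 - z) - Real.log z)) (Icc lo hi) x := by
    intro x _
    have d1 := ((hasDerivAt_id x).sub_const 1).const_rpow h1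
    have d2 := (hasDerivAt_id x).neg.const_rpow h0
    refine ((d1.mul d2).congr_deriv ?_).hasDerivWithinAt
    simp only [id, Pi.neg_apply]
    ring
  have hbd : ∀ x ∈ Icc lo hi,
      ‖(1 - z) ^ (x - 1) * z ^ (-x) * (Real.log (1 - z) - Real.log z)‖
        ≤ 2 / ε * ((1 - z) ^ (lo - 1 - ε) * z ^ (-hi - ε)) := by
    intro x hx
    have l1 := abs_log_le_rpow_neg_div h1 (by linarith) hε
    have l2 := abs_log_le_rpow_neg_div h0 hz.2.le hε
    have g1 : 1 ≤ (1 - z) ^ (-ε) :=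
      Real.one_le_rpow_of_pos_of_le_one_of_nonpos h1 (by linarith) (by linarith)
    have g2 : 1 ≤ z ^ (-ε) :=
      Real.one_le_rpow_of_pos_of_le_one_of_nonpos h0 hz.2.le (by linarith)
    have hlog : |Real.log (1 - z) - Real.log z| ≤ 2 / ε * ((1 - z) ^ (-ε) * z ^ (-ε)) := by
      calc |Real.log (1 - z) - Real.log z| ≤ |Real.log (1 - z)| + |Real.log z| := abs_sub _ _
        _ ≤ 1 / ε * ((1 - z) ^ (-ε) * 1) + 1 / ε * (1 * z ^ (-ε)) := by linarith
        _ ≤ 1 / ε * ((1 - z) ^ (-ε) * z ^ (-ε)) + 1 / ε * ((1 - z) ^ (-ε) * z ^ (-ε)) := by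
          gcongr
        _ = _ := by ring
    rw [norm_mul, Real.norm_of_nonneg (by positivity), Real.norm_eq_abs]
    calc _ ≤ (1 - z) ^ (lo - 1) * z ^ (-hi) * (2 / ε * ((1 - z) ^ (-ε) * z ^ (-ε))) :=
          mul_le_mul (one_sub_rpow_mul_rpow_neg_le hx hz) hlog (abs_nonneg _) (by positivity)
      _ = _ := by
          rw [sub_eq_add_neg (lo - 1), sub_eq_add_neg (-hi), Real.rpow_add h1, Real.rpow_add h0]
          ring
  exact (convex_Icc lo hi).norm_image_sub_le_of_norm_hasDerivWithin_le hderiv hbd hb ha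

lemma intervalIntegrable_variable_exponent {lo hi : ℝ} (hlo : 0 < lo) (hhi : hi < 1) {β : ℝ → ℝ}
    (hβ : ContinuousOn β (Ioo 0 1)) (hmem : ∀ z ∈ Ioo (0:ℝ) 1, β z ∈ Icc lo hi) :
    IntervalIntegrable (fun z => (1 - z) ^ (β z - 1) * z ^ (-β z)) volume 0 1 := by
  have hdom := intervalIntegrable_one_sub_rpow_mul_rpow (p := lo - 1) (q := -hi)
    (by linarith) (by linarith)
  rw [intervalIntegrable_iff_integrableOn_Ioo_of_le zero_le_one] at hdom ⊢
  refine Integrable.mono' hdom ?_ ?_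
  · refine ContinuousOn.aestronglyMeasurable ?_ measurableSet_Ioo
    refine ContinuousOn.mul (ContinuousOn.rpow (by fun_prop) (by fun_prop) ?_)
      (ContinuousOn.rpow (by fun_prop) (by fun_prop) ?_)
    · intro z hz
      exact Or.inl (sub_pos.2 hz.2).ne'
    · intro z hz
      exact Or.inl hz.1.ne'
  · refine (ae_restrict_iff' measurableSet_Ioo).2 (Eventually.of_forall fun z hz => ?_)
    have h0 : 0 < z := hz.1
    have h1 : 0 < 1 - z := sub_pos.2 hz.2
    rw [Real.norm_of_nonneg (by positivity)]
    exact one_sub_rpow_mul_rpow_neg_le (hmem z hz) hz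

/-- The Beta-type integral with variable exponent is Lipschitz in the exponent function. -/
lemma exists_abs_integral_variable_exponent_sub_le {lo hi : ℝ} (hlo : 0 < lo) (hhi : hi < 1) :
    ∃ C : ℝ, 0 ≤ C ∧ ∀ (β₁ β₂ : ℝ → ℝ) (δ : ℝ),
      ContinuousOn β₁ (Ioo 0 1) → ContinuousOn β₂ (Ioo 0 1) →
      (∀ z ∈ Ioo (0:ℝ) 1, β₁ z ∈ Icc lo hi) → (∀ z ∈ Ioo (0:ℝ) 1, β₂ z ∈ Icc lo hi) →
      (∀ z ∈ Ioo (0:ℝ) 1, |β₁ z - β₂ z| ≤ δ) →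
      |(∫ z in (0:ℝ)..1, (1 - z) ^ (β₁ z - 1) * z ^ (-β₁ z))
        - ∫ z in (0:ℝ)..1, (1 - z) ^ (β₂ z - 1) * z ^ (-β₂ z)| ≤ C * δ := by
  obtain ⟨ε, hε, hε1, hε2⟩ : ∃ ε : ℝ, 0 < ε ∧ ε < lo ∧ ε < 1 - hi := by
    obtain ⟨ε, h1, h2⟩ := exists_between (lt_min hlo (sub_pos.2 hhi))
    exact ⟨ε, h1, lt_min_iff.1 h2⟩
  set Φ : ℝ → ℝ := fun z => 2 / ε * ((1 - z) ^ (lo - 1 - ε) * z ^ (-hi - ε)) with hΦ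
  have hΦi : IntervalIntegrable Φ volume 0 1 :=
    (intervalIntegrable_one_sub_rpow_mul_rpow (by linarith) (by linarith)).const_mul _
  have hΦ0 : ∀ z ∈ Icc (0:ℝ) 1, 0 ≤ Φ z := by
    intro z hz
    have h0 : 0 ≤ z := hz.1
    have h1 : 0 ≤ 1 - z := sub_nonneg.2 hz.2
    simp only [hΦ]
    positivity
  refine ⟨∫ z in (0:ℝ)..1, Φ z, intervalIntegral.integral_nonneg zero_le_one hΦ0, ?_⟩
  intro β₁ β₂ δ hc₁ hc₂ hm₁ hm₂ hδ
  rw [← intervalIntegral.integral_sub (intervalIntegrable_variable_exponent hlo hhi hc₁ hm₁)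
    (intervalIntegrable_variable_exponent hlo hhi hc₂ hm₂), ← intervalIntegral.integral_mul_const,
    ← Real.norm_eq_abs]
  refine intervalIntegral.norm_integral_le_of_norm_le zero_le_one ?_ (hΦi.mul_const δ)
  filter_upwards [Measure.ae_ne volume (1:ℝ)] with z hz1 hz
  have hz' : z ∈ Ioo (0:ℝ) 1 := ⟨hz.1, lt_of_le_of_ne hz.2 hz1⟩
  exact (abs_sub_one_sub_rpow_mul_rpow_neg_le hε (hm₁ z hz') (hm₂ z hz') hz').trans
    (mul_le_mul_of_nonneg_left (hδ z hz') (hΦ0 z ⟨hz'.1.le, hz'.2.le⟩))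

/-- Leibniz rule for a kernel that is jointly Lipschitz on a square. -/
lemma hasDerivAt_integral_mul_of_lipschitz {T C : ℝ} {g : ℝ → ℝ} {K : ℝ → ℝ → ℝ} {L : ℝ → ℝ}
    {t : ℝ} (hC : 0 ≤ C) (hg : ContinuousOn g (Icc 0 T)) (ht : t ∈ Ioo 0 T)
    (hK : ∀ y ∈ Icc 0 T, ∀ y' ∈ Icc 0 T, ∀ τ ∈ Icc 0 T, ∀ τ' ∈ Icc 0 T,
      |K y τ - K y' τ'| ≤ C * (|τ - τ'| + |y - y'|))
    (hL : ∀ s ∈ Icc 0 t, HasDerivAt (K s) (L s) t) :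
    HasDerivAt (fun τ => ∫ y in (0:ℝ)..τ, g y * K y τ)
      (g t * K t t + ∫ s in (0:ℝ)..t, g s * L s) t := by
  have htm : t ∈ Icc 0 T := Ioo_subset_Icc_self ht
  have hnhds : Icc 0 T ∈ 𝓝 t := Icc_mem_nhds ht.1 ht.2
  have h0m : (0:ℝ) ∈ Icc 0 T := ⟨le_rfl, htm.1.trans htm.2⟩
  have hKc : ∀ τ ∈ Icc 0 T, ContinuousOn (fun y => K y τ) (Icc 0 T) := by
    intro τ hτ
    refine (LipschitzOnWith.of_dist_le_mul (K := C.toNNReal) fun y hy y' hy' => ?_).continuousOn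
    simpa [Real.dist_eq, hC] using hK y hy y' hy' τ hτ τ hτ
  have hint : ∀ τ ∈ Icc 0 T, ∀ a ∈ Icc 0 T, ∀ b ∈ Icc 0 T,
      IntervalIntegrable (fun y => g y * K y τ) volume a b := fun τ hτ a ha b hb =>
    ((hg.mul (hKc τ hτ)).mono (uIcc_subset_Icc ha hb)).intervalIntegrable
  obtain ⟨M, hM⟩ := isCompact_Icc.exists_bound_of_continuousOn hg
  have hM0 : 0 ≤ M := (norm_nonneg _).trans (hM t htm)
  have hA : HasDerivAt (fun τ => ∫ y in (0:ℝ)..τ, g y * K y t) (g t * K t t) t := by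
    refine intervalIntegral.integral_hasDerivAt_right (hint t htm 0 h0m t htm) ?_
      ((hg.mul (hKc t htm)).continuousAt hnhds)
    exact ⟨Icc 0 T, hnhds, (hg.mul (hKc t htm)).aestronglyMeasurable measurableSet_Icc⟩
  have hsub : uIoc 0 t ⊆ Icc 0 t := by
    rw [uIoc_of_le htm.1]
    exact Ioc_subset_Icc_self
  have hsubT : Icc 0 t ⊆ Icc 0 T := Icc_subset_Icc_right htm.2
  have hmeas : ∀ τ ∈ Icc 0 T,
      AEStronglyMeasurable (fun y => g y * K y τ) (volume.restrict (uIoc 0 t)) := fun τ hτ =>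
    (hint τ hτ 0 h0m t htm).def'.aestronglyMeasurable
  have hB : HasDerivAt (fun τ => ∫ y in (0:ℝ)..t, g y * K y τ) (∫ s in (0:ℝ)..t, g s * L s) t := by
    refine (intervalIntegral.hasDerivAt_integral_of_dominated_loc_of_lip
      (F := fun τ y => g y * K y τ) (bound := fun _ => M * C) hnhds
      (eventually_of_mem hnhds hmeas) (hint t htm 0 h0m t htm) ?_ ?_
      intervalIntegrable_const ?_).2
    · obtain ⟨u, -, hu⟩ := exists_seq_strictAnti_tendsto' ht.2
      have hut : Tendsto u atTop (𝓝[≠] t) := tendsto_nhdsWithin_iff.2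
        ⟨hu.2, Eventually.of_forall fun n => (hu.1 n).1.ne'⟩
      refine aestronglyMeasurable_of_tendsto_ae atTop
        (f := fun n y => (u n - t)⁻¹ * (g y * K y (u n) - g y * K y t)) (fun n => ?_) ?_
      · exact ((hmeas _ ⟨htm.1.trans (hu.1 n).1.le, (hu.1 n).2.le⟩).sub (hmeas t htm)).const_mul _
      · refine (ae_restrict_iff' measurableSet_uIoc).2 (Eventually.of_forall fun s hs => ?_)
        have hd := ((hL s (hsub hs)).const_mul (g s)).tendsto_slope.comp hut
        refine hd.congr fun n => ?_
        simp [slope_def_field, div_eq_inv_mul]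
    · refine Eventually.of_forall fun s hs => LipschitzOnWith.of_dist_le_mul fun τ hτ τ' hτ' => ?_
      have hs' := hsubT (hsub hs)
      have h := hK s hs' s hs' τ hτ τ' hτ'
      simp only [sub_self, abs_zero, add_zero] at h
      rw [Real.dist_eq, Real.dist_eq, ← mul_sub, abs_mul, Real.coe_nnabs,
        abs_of_nonneg (mul_nonneg hM0 hC), mul_assoc]
      exact mul_le_mul (hM s hs') h (abs_nonneg _) hM0
    · exact Eventually.of_forall fun s hs => (hL s (hsub hs)).const_mul (g s)
  have hE : HasDerivAt (fun τ => ∫ y in t..τ, g y * (K y τ - K y t)) 0 t := by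
    rw [hasDerivAt_iff_isLittleO]
    have hO : (fun τ => (∫ y in t..τ, g y * (K y τ - K y t))) =O[𝓝 t] fun τ => (τ - t) ^ 2 := by
      refine Asymptotics.IsBigO.of_bound (M * C) (eventually_of_mem hnhds fun τ hτ => ?_)
      have h := intervalIntegral.norm_integral_le_of_norm_le_const (a := t) (b := τ)
        (f := fun y => g y * (K y τ - K y t)) (C := M * (C * |τ - t|)) fun y hy => by
          have hy' : y ∈ Icc 0 T := uIcc_subset_Icc htm hτ (uIoc_subset_uIcc hy)
          have h := hK y hy' y hy' τ hτ t htm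
          simp only [sub_self, abs_zero, add_zero] at h
          rw [norm_mul]
          exact mul_le_mul (hM y hy') h (abs_nonneg _) hM0
      refine h.trans_eq ?_
      rw [norm_pow, Real.norm_eq_abs]
      ring
    have ho : (fun τ : ℝ => (τ - t) ^ 2) =o[𝓝 t] fun τ => τ - t := by
      have := (Asymptotics.isLittleO_pow_id (𝕜 := ℝ) one_lt_two).comp_tendsto
        (show Tendsto (fun τ => τ - t) (𝓝 t) (𝓝 0) from tendsto_sub_nhds_zero_iff.2 tendsto_id)
      exact this
    simpa using hO.trans_isLittleO ho
  have hsum := ((hA.add hB).sub_const (∫ y in (0:ℝ)..t, g y * K y t)).add hE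
  rw [add_zero] at hsum
  refine hsum.congr_of_eventuallyEq (eventually_of_mem hnhds fun τ hτ => ?_)
  simp only [Pi.add_apply, mul_sub]
  rw [intervalIntegral.integral_sub (hint τ hτ t htm τ hτ) (hint t htm t htm τ hτ),
    ← intervalIntegral.integral_add_adjacent_intervals (hint τ hτ 0 h0m t htm)
      (hint τ hτ t htm τ hτ),
    ← intervalIntegral.integral_add_adjacent_intervals (hint t htm 0 h0m t htm)
      (hint t htm t htm τ hτ)]
  ring

/-- Approximate inversion: `D^{α(t)} Î^{α(t)} g(t) = γ(t) g(t) + ∫_0^t L(s,t) g(s) ds`,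
where `γ(t) = Γ(α(t))Γ(1-α(t))` and
`L(s,t) = ∂_t ∫_0^1 (1-z)^{α((t-s)z+s)-1} z^{-α((t-s)z+s)} dz`. -/
theorem abel_approximate_inversion_deriv_hat
    (T : ℝ) (hT : 0 < T) (α : ℝ → ℝ) (αlo αhi : ℝ)
    (hα : ContDiffOn ℝ 1 α (Icc 0 T))
    (hlo : 0 < αlo) (hhi : αhi < 1)
    (hbound : ∀ t ∈ Icc 0 T, αlo ≤ α t ∧ α t ≤ αhi)
    (g : ℝ → ℝ) (hg : ContinuousOn g (Icc 0 T))
    (L : ℝ → ℝ → ℝ)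
    (hL : ∀ s t : ℝ, 0 ≤ s → s ≤ t → t ≤ T →
      HasDerivAt
        (fun τ => ∫ z in (0:ℝ)..1,
          (1 - z) ^ (α ((τ - s) * z + s) - 1) * z ^ (-α ((τ - s) * z + s))) (L s t) t)
    (t : ℝ) (ht : t ∈ Ioo 0 T) :
    HasDerivAt
      (fun τ => ∫ y in (0:ℝ)..τ, g y *
        ∫ z in (0:ℝ)..1, (1 - z) ^ (α ((τ - y) * z + y) - 1) * z ^ (-α ((τ - y) * z + y)))
      (Real.Gamma (α t) * Real.Gamma (1 - α t) * g t + ∫ s in (0:ℝ)..t, L s t * g s) t := by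
  have hconv : ∀ y ∈ Icc 0 T, ∀ τ ∈ Icc 0 T, ∀ z ∈ Ioo (0:ℝ) 1, (τ - y) * z + y ∈ Icc 0 T := by
    intro y hy τ hτ z hz
    convert! (convex_Icc 0 T) hτ hy hz.1.le (sub_nonneg.2 hz.2.le) (by ring) using 1
    simp only [smul_eq_mul]
    ring
  obtain ⟨M, hM⟩ := hα.exists_lipschitzOnWith one_ne_zero (convex_Icc 0 T) isCompact_Icc
  obtain ⟨C, hC0, hC⟩ := exists_abs_integral_variable_exponent_sub_le hlo hhi
  have hcont : ∀ y ∈ Icc 0 T, ∀ τ ∈ Icc 0 T,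
      ContinuousOn (fun z => α ((τ - y) * z + y)) (Ioo 0 1) := fun y hy τ hτ =>
    hα.continuousOn.comp (by fun_prop) (hconv y hy τ hτ)
  have hmem : ∀ y ∈ Icc 0 T, ∀ τ ∈ Icc 0 T, ∀ z ∈ Ioo (0:ℝ) 1,
      α ((τ - y) * z + y) ∈ Icc αlo αhi := fun y hy τ hτ z hz =>
    hbound _ (hconv y hy τ hτ z hz)
  have htm : t ∈ Icc 0 T := Ioo_subset_Icc_self ht
  have key := hasDerivAt_integral_mul_of_lipschitz (C := C * M) (L := fun s => L s t)
    (K := fun y τ => ∫ z in (0:ℝ)..1,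
      (1 - z) ^ (α ((τ - y) * z + y) - 1) * z ^ (-α ((τ - y) * z + y)))
    (by positivity) hg ht ?_ fun s hs => hL s t hs.1 hs.2 ht.2.le
  · convert! key using 1
    congr 1
    · simp only [sub_self, zero_mul, zero_add]
      rw [integral_one_sub_rpow_mul_rpow_neg (hlo.trans_le (hbound t htm).1)
        ((hbound t htm).2.trans_lt hhi)]
      ring
    · simp only [mul_comm]
  · intro y hy y' hy' τ hτ τ' hτ'
    rw [mul_assoc]
    refine hC _ _ _ (hcont y hy τ hτ) (hcont y' hy' τ' hτ') (hmem y hy τ hτ) (hmem y' hy' τ' hτ')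
      fun z hz => ?_
    have h := hM.dist_le_mul _ (hconv y hy τ hτ z hz) _ (hconv y' hy' τ' hτ' z hz)
    rw [Real.dist_eq, Real.dist_eq] at h
    refine h.trans (mul_le_mul_of_nonneg_left ?_ M.2)
    have e : (τ - y) * z + y - ((τ' - y') * z + y') = (τ - τ') * z + (y - y') * (1 - z) := by ring
    rw [e]
    refine (abs_add_le _ _).trans ?_
    rw [abs_mul, abs_mul, abs_of_pos hz.1, abs_of_pos (sub_pos.2 hz.2)]
    exact add_le_add (mul_le_of_le_one_right (abs_nonneg _) hz.2.le)
      (mul_le_of_le_one_right (abs_nonneg _) (by linarith [hz.1]))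
end

section
/- Let $T>0$, let $\alpha\in C^1[0,T]$ satisfy $0<\alpha_*\le\alpha(t)\le\alpha^*<1$ on $[0,T]$, and let $h\in C[0,T]$. Suppose $u\in C[0,T]$ satisfies the variable-exponent Riemann–Liouville fractional differential equation $D_t^{\alpha(t)}u(t)=h(t)$ for all $t\in(0,T]$, where $D_t^{\alpha(t)}u(t)=\partial_t\int_0^t\frac{u(s)}{\Gamma(1-\alpha(s))(t-s)^{\alpha(s)}}ds$. Then necessarily $u(0)=0$. In particular, the initial value problem $D_t^{\alpha(t)}u=h$, $u(0)=u_0$ has no continuous solution on $[0,T]$ unless $u_0=0$. -/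
open Set MeasureTheory Filter
open scoped Topology

/-- Two-sided power bounds for a weakly singular integral of variable order whose weight lies
between two positive constants. -/
lemma variableOrder_integral_bounds {t a b c C : ℝ} {α w : ℝ → ℝ} (ht : 0 < t) (ht1 : t ≤ 1)
    (ha : 0 < a) (hb : b < 1) (hc : 0 ≤ c)
    (hα : ContinuousOn α (Icc 0 t)) (hw : ContinuousOn w (Icc 0 t))
    (hαb : ∀ s ∈ Icc 0 t, a ≤ α s ∧ α s ≤ b) (hwb : ∀ s ∈ Icc 0 t, c ≤ w s ∧ w s ≤ C) :
    c * t ^ (1 - a) ≤ ∫ s in (0:ℝ)..t, w s * (t - s) ^ (-α s) ∧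
      (∫ s in (0:ℝ)..t, w s * (t - s) ^ (-α s)) ≤ C * (t ^ (1 - b) / (1 - b)) := by
  have hle : ∀ s ∈ Ioo 0 t, w s * (t - s) ^ (-α s) ≤ C * (t - s) ^ (-b) := by
    intro s hs
    have hs' := Ioo_subset_Icc_self hs
    have hpos : 0 < t - s := sub_pos.2 hs.2
    exact mul_le_mul (hwb s hs').2
      (Real.rpow_le_rpow_of_exponent_ge hpos (by linarith [hs.1]) (by linarith [(hαb s hs').2]))
      (by positivity) (hc.trans ((hwb s hs').1.trans (hwb s hs').2))
  have hge : ∀ s ∈ Ioo 0 t, c * t ^ (-a) ≤ w s * (t - s) ^ (-α s) := by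
    intro s hs
    have hs' := Ioo_subset_Icc_self hs
    have hpos : 0 < t - s := sub_pos.2 hs.2
    refine mul_le_mul (hwb s hs').1 ?_ (by positivity) (hc.trans (hwb s hs').1)
    calc t ^ (-a) ≤ (t - s) ^ (-a) :=
          Real.rpow_le_rpow_of_nonpos hpos (by linarith [hs.1]) (by linarith)
      _ ≤ (t - s) ^ (-α s) :=
          Real.rpow_le_rpow_of_exponent_ge hpos (by linarith [hs.1])
            (by linarith [(hαb s hs').1])
  have hint_upper : IntervalIntegrable (fun s => C * (t - s) ^ (-b)) volume 0 t := by
    have := (intervalIntegral.intervalIntegrable_rpow' (a := t) (b := 0) (r := -b)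
      (by linarith)).comp_sub_left t
    simpa using this.const_mul C
  have hint : IntervalIntegrable (fun s => w s * (t - s) ^ (-α s)) volume 0 t := by
    rw [intervalIntegrable_iff_integrableOn_Ioo_of_le ht.le] at hint_upper ⊢
    refine Integrable.mono' hint_upper ?_ ?_
    · refine ContinuousOn.aestronglyMeasurable ?_ measurableSet_Ioo
      refine (hw.mono Ioo_subset_Icc_self).mul (ContinuousOn.rpow (by fun_prop)
        (hα.mono Ioo_subset_Icc_self).neg fun s hs => Or.inl (sub_pos.2 hs.2).ne')
    · filter_upwards [ae_restrict_mem measurableSet_Ioo] with s hs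
      rw [Real.norm_of_nonneg (le_trans (by positivity) (hge s hs))]
      exact hle s hs
  constructor
  · have hmono := intervalIntegral.integral_mono_on_of_le_Ioo ht.le
      (intervalIntegrable_const (c := c * t ^ (-a))) hint hge
    rw [intervalIntegral.integral_const, smul_eq_mul, sub_zero] at hmono
    refine le_trans (le_of_eq ?_) hmono
    rw [sub_eq_add_neg, Real.rpow_add ht, Real.rpow_one]
    ring
  · refine (intervalIntegral.integral_mono_on_of_le_Ioo ht.le hint hint_upper hle).trans_eq ?_
    rw [intervalIntegral.integral_const_mul,
      intervalIntegral.integral_comp_sub_left (fun x : ℝ => x ^ (-b)), sub_self, sub_zero,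
      integral_rpow (Or.inl (by linarith)), Real.zero_rpow (by linarith), sub_zero,
      neg_add_eq_sub]

/-- If the variable-order integral of a continuous weight has a bounded derivative on `(0, T]`,
the weight is nonpositive at `0`. -/
lemma weight_zero_nonpos_of_hasDerivWithinAt {T a b M : ℝ} {α w h : ℝ → ℝ} (hT : 0 < T)
    (ha : 0 < a) (hb : b < 1)
    (hα : ContinuousOn α (Icc 0 T)) (hw : ContinuousOn w (Icc 0 T))
    (hαb : ∀ s ∈ Icc 0 T, a ≤ α s ∧ α s ≤ b) (hM : ∀ t ∈ Icc 0 T, ‖h t‖ ≤ M)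
    (hderiv : ∀ t ∈ Ioc 0 T, HasDerivWithinAt
      (fun τ => ∫ s in (0:ℝ)..τ, w s * (τ - s) ^ (-α s)) (h t) (Icc 0 T) t) :
    w 0 ≤ 0 := by
  by_contra! hw0
  set F : ℝ → ℝ := fun τ => ∫ s in (0:ℝ)..τ, w s * (τ - s) ^ (-α s) with hF
  obtain ⟨δ, hδ, hδw⟩ : ∃ δ > 0, ∀ s ∈ Icc 0 T, s < δ → w 0 / 2 ≤ w s ∧ w s ≤ 2 * w 0 := by
    obtain ⟨δ, hδ, hd⟩ := Metric.continuousOn_iff.1 hw 0 (left_mem_Icc.2 hT.le) (w 0 / 2)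
      (by positivity)
    refine ⟨δ, hδ, fun s hs hsδ => ?_⟩
    have := hd s hs (by rwa [Real.dist_eq, sub_zero, abs_of_nonneg hs.1])
    rw [Real.dist_eq, abs_lt] at this
    constructor <;> linarith
  have hsmall : ∀ᶠ t in 𝓝[>] (0:ℝ), 0 < t ∧ t < T ∧ t < δ ∧ t < 1 := by
    filter_upwards [self_mem_nhdsWithin, Ioo_mem_nhdsGT hT, Ioo_mem_nhdsGT hδ,
      Ioo_mem_nhdsGT (zero_lt_one (α := ℝ))] with t h0 h1 h2 h3
    exact ⟨h0, h1.2, h2.2, h3.2⟩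
  have hbounds : ∀ᶠ t in 𝓝[>] (0:ℝ), w 0 / 2 * t ^ (1 - a) ≤ F t ∧
      F t ≤ 2 * w 0 * (t ^ (1 - b) / (1 - b)) := by
    filter_upwards [hsmall] with t ⟨ht, htT, htδ, ht1⟩
    have hsub : Icc 0 t ⊆ Icc 0 T := Icc_subset_Icc_right htT.le
    exact variableOrder_integral_bounds ht ht1.le ha hb (by positivity) (hα.mono hsub)
      (hw.mono hsub) (fun s hs => hαb s (hsub hs))
      fun s hs => hδw s (hsub hs) (hs.2.trans_lt htδ)
  have hrpow : ∀ {r : ℝ}, 0 < r → Tendsto (fun t : ℝ => t ^ r) (𝓝[>] 0) (𝓝 0) := by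
    intro r hr
    have := (Real.continuousAt_rpow_const 0 r (Or.inr hr.le)).tendsto
    rw [Real.zero_rpow hr.ne'] at this
    exact this.mono_left nhdsWithin_le_nhds
  have hF0 : Tendsto F (𝓝[>] 0) (𝓝 0) := by
    have hup : Tendsto (fun t : ℝ => 2 * w 0 * (t ^ (1 - b) / (1 - b))) (𝓝[>] 0) (𝓝 0) := by
      simpa using ((hrpow (sub_pos.2 hb)).div_const (1 - b)).const_mul (2 * w 0)
    refine tendsto_of_tendsto_of_tendsto_of_le_of_le' tendsto_const_nhds hup ?_ ?_
    · filter_upwards [hbounds, hsmall] with t hFt ht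
      have := ht.1
      exact le_trans (by positivity) hFt.1
    · exact hbounds.mono fun t hFt => hFt.2
  have hlin : ∀ t ∈ Ioc 0 T, F t ≤ M * t := by
    intro t ht
    have hlim : Tendsto (fun ε => F t - F ε) (𝓝[>] 0) (𝓝 (F t)) := by
      simpa using hF0.const_sub (F t)
    have hlimR : Tendsto (fun ε => M * (t - ε)) (𝓝[>] 0) (𝓝 (M * t)) := by
      have : Tendsto (fun ε => M * (t - ε)) (𝓝 0) (𝓝 (M * (t - 0))) :=
        Continuous.tendsto (by fun_prop) 0
      rw [sub_zero] at this
      exact this.mono_left nhdsWithin_le_nhds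
    refine le_of_tendsto_of_tendsto hlim hlimR ?_
    filter_upwards [Ioo_mem_nhdsGT ht.1] with ε hε
    have hmvt := Convex.norm_image_sub_le_of_norm_hasDerivWithin_le
      (fun x hx => (hderiv x hx).mono Ioc_subset_Icc_self)
      (fun x hx => hM x (Ioc_subset_Icc_self hx)) (convex_Ioc 0 T)
      ⟨hε.1, hε.2.le.trans ht.2⟩ ht
    rw [Real.norm_of_nonneg (sub_nonneg.2 hε.2.le)] at hmvt
    exact (le_abs_self _).trans hmvt
  have hlim : Tendsto (fun t : ℝ => M * t ^ a) (𝓝[>] 0) (𝓝 0) := by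
    simpa using (hrpow ha).const_mul M
  have hcontra : w 0 / 2 ≤ 0 := by
    refine ge_of_tendsto hlim ?_
    filter_upwards [hbounds, hsmall] with t hFt ht
    have hp : 0 < t ^ (1 - a) := Real.rpow_pos_of_pos ht.1 _
    have hsplit : t ^ a * t ^ (1 - a) = t := by
      rw [← Real.rpow_add ht.1, add_sub_cancel, Real.rpow_one]
    refine le_of_mul_le_mul_right ?_ hp
    rw [mul_assoc, hsplit]
    exact hFt.1.trans (hlin t ⟨ht.1, ht.2.1.le⟩)
  linarith

/-- If `0 < α_* ≤ α(t) ≤ α^* < 1` on `[0,T]` and a continuous `u` solves the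
variable-exponent Riemann–Liouville equation
`∂_t ∫_0^t u(s) (t-s)^{-α(s)} / Γ(1-α(s)) ds = h(t)` on `(0,T]`, then necessarily
`u(0) = 0`: the Cauchy problem with `u(0) = u₀ ≠ 0` has no continuous solution. -/
theorem RL_FDE_initial_value_rigidity
    (T : ℝ) (hT : 0 < T) (α : ℝ → ℝ) (αlo αhi : ℝ)
    (hα : ContDiffOn ℝ 1 α (Icc 0 T))
    (hlo : 0 < αlo) (hhi : αhi < 1)
    (hbound : ∀ t ∈ Icc 0 T, αlo ≤ α t ∧ α t ≤ αhi)
    (h : ℝ → ℝ) (hh : ContinuousOn h (Icc 0 T))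
    (u : ℝ → ℝ) (hu : ContinuousOn u (Icc 0 T))
    (hFDE : ∀ t ∈ Ioc 0 T,
      HasDerivWithinAt
        (fun τ => ∫ s in (0:ℝ)..τ, u s * (τ - s) ^ (-α s) / Real.Gamma (1 - α s))
        (h t) (Icc 0 T) t) :
    u 0 = 0 := by
  have hαc := hα.continuousOn
  have hpos : ∀ s ∈ Icc 0 T, 0 < 1 - α s := fun s hs => by linarith [(hbound s hs).2]
  have hΓ : ∀ s ∈ Icc 0 T, 0 < Real.Gamma (1 - α s) := fun s hs =>
    Real.Gamma_pos_of_pos (hpos s hs)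
  have hw : ContinuousOn (fun s => u s / Real.Gamma (1 - α s)) (Icc 0 T) := by
    refine hu.div (fun s hs => ?_) fun s hs => (hΓ s hs).ne'
    refine ContinuousAt.comp_continuousWithinAt (g := Real.Gamma) ?_
      (continuousWithinAt_const.sub (hαc s hs))
    refine (Real.differentiableAt_Gamma fun m => ?_).continuousAt
    have := hpos s hs
    have : (0:ℝ) ≤ m := m.cast_nonneg
    linarith
  obtain ⟨M, hM⟩ := isCompact_Icc.exists_bound_of_continuousOn hh
  have h0 : (0:ℝ) ∈ Icc 0 T := left_mem_Icc.2 hT.le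
  have hle := weight_zero_nonpos_of_hasDerivWithinAt hT hlo hhi hαc hw hbound hM
    (fun t ht => by simpa only [div_mul_eq_mul_div] using hFDE t ht)
  have hge := weight_zero_nonpos_of_hasDerivWithinAt (h := fun t => -h t) hT hlo hhi hαc hw.neg
    hbound (fun t ht => by simpa only [norm_neg] using hM t ht)
    (fun t ht => by
      simpa only [Pi.neg_apply, neg_mul, div_mul_eq_mul_div, intervalIntegral.integral_neg]
        using (hFDE t ht).fun_neg)
  have hzero : u 0 / Real.Gamma (1 - α 0) = 0 :=
    le_antisymm hle (neg_nonpos.1 hge)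
  exact (div_eq_zero_iff.1 hzero).resolve_right (hΓ 0 h0).ne'
end
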